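/- Let λ > -1. The map (y₁,y₂) ↦ (q(y₁,y₂), β(y₁,y₂)) restricted to the closed half-plane {(y₁,y₂) ∈ ℝ² : y₁ ≥ 0} is a bijection onto the set {(q,β) ∈ ℝ² : 0 < q ≤ 1 and β² ≤ 1 - q^{2(1+λ)}}. In particular, the compactified coordinates map the unbounded half-plane bijectively onto a bounded region. -/

import Mathlib

/-- The compactifying coordinate `q(y₁,y₂) = (1+y₁²+y₂²)^{-1/(2(1+λ))}`. -/
noncomputable def qCoord (lam y1 y2 : ℝ) : ℝ :=
  (1 + y1 ^ 2 + y2 ^ 2) ^ (-(1 / (2 * (1 + lam))))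

/-- The compactified coordinate `β(y₁,y₂) = y₂ / √(1+y₁²+y₂²)`. -/
noncomputable def betaCoord (y1 y2 : ℝ) : ℝ :=
  y2 / Real.sqrt (1 + y1 ^ 2 + y2 ^ 2)

theorem one_add_sq_add_sq_pos (y1 y2 : ℝ) : 0 < 1 + y1 ^ 2 + y2 ^ 2 := by positivity

theorem qCoord_pos (lam y1 y2 : ℝ) : 0 < qCoord lam y1 y2 :=
  Real.rpow_pos_of_pos (one_add_sq_add_sq_pos y1 y2) _

theorem qCoord_rpow {lam : ℝ} (hlam : -1 < lam) (y1 y2 : ℝ) :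
    qCoord lam y1 y2 ^ (2 * (1 + lam)) = (1 + y1 ^ 2 + y2 ^ 2)⁻¹ := by
  have hm : 2 * (1 + lam) ≠ 0 := by linarith
  rw [qCoord, ← Real.rpow_mul (one_add_sq_add_sq_pos y1 y2).le, neg_mul,
    one_div_mul_cancel hm, Real.rpow_neg_one]

theorem qCoord_le_one {lam : ℝ} (hlam : -1 < lam) (y1 y2 : ℝ) : qCoord lam y1 y2 ≤ 1 := by
  have hm : 0 < 2 * (1 + lam) := by linarith
  refine Real.rpow_le_one_of_one_le_of_nonpos (by nlinarith [sq_nonneg y1, sq_nonneg y2]) ?_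
  exact neg_nonpos.mpr (one_div_pos.mpr hm).le

theorem betaCoord_sq (y1 y2 : ℝ) :
    betaCoord y1 y2 ^ 2 = y2 ^ 2 / (1 + y1 ^ 2 + y2 ^ 2) := by
  rw [betaCoord, div_pow, Real.sq_sqrt (one_add_sq_add_sq_pos y1 y2).le]

/-- For `λ > -1`, the map `(y₁,y₂) ↦ (q,β)` restricted to the closed
half-plane `{y₁ ≥ 0}` is a bijection onto `{(q,β) : 0 < q ≤ 1 ∧ β² ≤ 1 - q^(2(1+λ))}`. -/
theorem compactified_coordinates_bijOn (lam : ℝ) (hlam : -1 < lam) :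
    Set.BijOn (fun p : ℝ × ℝ => (qCoord lam p.1 p.2, betaCoord p.1 p.2))
      {p : ℝ × ℝ | 0 ≤ p.1}
      {z : ℝ × ℝ | 0 < z.1 ∧ z.1 ≤ 1 ∧ z.2 ^ 2 ≤ 1 - z.1 ^ (2 * (1 + lam))} := by
  have hm : 2 * (1 + lam) ≠ 0 := by linarith
  refine ⟨?_, ?_, ?_⟩
  · rintro ⟨y1, y2⟩ -
    refine ⟨qCoord_pos lam y1 y2, qCoord_le_one hlam y1 y2, ?_⟩
    have hS := one_add_sq_add_sq_pos y1 y2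
    simp only [qCoord_rpow hlam, betaCoord_sq]
    rw [div_le_iff₀ hS, sub_mul, inv_mul_cancel₀ hS.ne']
    nlinarith [sq_nonneg y1]
  · rintro ⟨y1, y2⟩ hy ⟨z1, z2⟩ hz h
    rw [Set.mem_ofPred_eq] at hy hz
    obtain ⟨hq, hb⟩ := Prod.mk.inj h
    have hS : 1 + y1 ^ 2 + y2 ^ 2 = 1 + z1 ^ 2 + z2 ^ 2 := by
      rw [← inv_inj, ← qCoord_rpow hlam, ← qCoord_rpow hlam]
      exact congrArg (· ^ (2 * (1 + lam))) hq
    have h2 : y2 = z2 := by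
      simp only [betaCoord, hS] at hb
      exact (div_left_inj' (Real.sqrt_pos.mpr (one_add_sq_add_sq_pos z1 z2)).ne').mp hb
    subst h2
    exact Prod.ext ((sq_eq_sq₀ hy hz).mp (by linarith)) rfl
  · rintro ⟨q, b⟩ ⟨hq, -, hb⟩
    dsimp only at hq hb
    have hQ : 0 < q ^ (2 * (1 + lam)) := Real.rpow_pos_of_pos hq _
    set S := (q ^ (2 * (1 + lam)))⁻¹ with hSdef
    have hS : 0 < S := inv_pos.mpr hQ
    have hy : 0 ≤ S - 1 - b ^ 2 * S := by
      have := mul_le_mul_of_nonneg_right hb hS.le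
      rw [sub_mul, mul_inv_cancel₀ hQ.ne'] at this
      linarith
    have hsum : 1 + √(S - 1 - b ^ 2 * S) ^ 2 + (b * √S) ^ 2 = S := by
      rw [mul_pow, Real.sq_sqrt hy, Real.sq_sqrt hS.le]
      ring
    refine ⟨(√(S - 1 - b ^ 2 * S), b * √S), Real.sqrt_nonneg _, Prod.ext ?_ ?_⟩
    · simp only [qCoord, hsum]
      rw [hSdef, Real.inv_rpow hQ.le, Real.rpow_neg hQ.le, inv_inv, ← Real.rpow_mul hq.le,
        mul_one_div_cancel hm, Real.rpow_one]
    · simp only [betaCoord, hsum]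
      exact mul_div_cancel_right₀ b (Real.sqrt_pos.mpr hS).ne'
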